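/- Under the abstract stratification setting and Structural Hypotheses (i) and (ii): for every κ₀ ∈ (0,1), δ ∈ (0,1) and r₀ > 0 there exists a constant C = C(κ₀, δ, r₀, n, Ω) > 0 such that for every k ∈ {1, …, m − 1} and every 0 < r < r₀ one has |𝒯_r(S^k_{r, r₀, δ})| ≤ C · r^{n − k − κ₀}. -/

import Mathlib

open Metric MeasureTheory Set Filter

noncomputable section

/-- `core Ω s` is the set `Ω^s := {x ∈ Ω : dist(x, ∂Ω) ≥ 2s}`. -/
def core {n : ℕ} (Ω : Set (EuclideanSpace ℝ (Fin n))) (s : ℝ) :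
    Set (EuclideanSpace ℝ (Fin n)) :=
  {x ∈ Ω | 2 * s ≤ infDist x (frontier Ω)}

/-- The abstract stratification setting: a bounded open set `Ω ⊆ ℝⁿ`, a monotone family of
bounded nonnegative density functions `Θ_s` on `Ω^s`, and monotone control functions
`d_0 ≤ d_1 ≤ ⋯ ≤ d_m` on `U = {(x,s) : x ∈ Ω^s, Θ_0(x) > 0}`. -/
structure StratSetting (n : ℕ) where
  npos : 0 < n
  Ω : Set (EuclideanSpace ℝ (Fin n))
  isOpen : IsOpen Ω
  isBounded : Bornology.IsBounded Ω
  /-- the family of density functions -/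
  Θ : ℝ → EuclideanSpace ℝ (Fin n) → ℝ
  /-- the number of control functions -/
  m : ℕ
  mpos : 0 < m
  mle : m ≤ n
  /-- the control (distance) functions -/
  d : ℕ → EuclideanSpace ℝ (Fin n) → ℝ → ℝ
  Θ_nonneg : ∀ s x, 0 ≤ s → x ∈ core Ω s → 0 ≤ Θ s x
  Θ_mono : ∀ s s' x, 0 ≤ s → s < s' → x ∈ core Ω s' → Θ s x ≤ Θ s' x
  Θ_bdd : ∀ s₀ > 0, ∃ Λ > 0, ∀ s x, 0 ≤ s → s ≤ s₀ → x ∈ core Ω s₀ → Θ s x ≤ Λ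
  d_nonneg : ∀ k x s, x ∈ core Ω s → 0 < Θ 0 x → 0 ≤ d k x s
  d_mono : ∀ k x s, k < m → x ∈ core Ω s → 0 < Θ 0 x → d k x s ≤ d (k + 1) x s

namespace StratSetting

variable {n : ℕ} (S : StratSetting n)

/-- The set `U := {(x,s) : x ∈ Ω^s, Θ_0(x) > 0}`. -/
def U : Set (EuclideanSpace ℝ (Fin n) × ℝ) :=
  {p | p.1 ∈ core S.Ω p.2 ∧ 0 < S.Θ 0 p.1}

/-- Structural Hypothesis (i): quantitative differentiation. -/
def HypI : Prop :=
  ∀ s₀ > 0, ∀ ε₁ > 0, ∃ lam eta : ℝ,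
    0 < lam ∧ lam < 1 / 4 ∧ 0 < eta ∧ eta < 1 / 4 ∧
    ∀ x s, (x, s) ∈ S.U → x ∈ core S.Ω s₀ → s < s₀ →
      S.Θ s x - S.Θ (lam * s) x ≤ eta → S.d 0 x s ≤ ε₁

/-- Structural Hypothesis (ii): consistency of the control functions. -/
def HypII : Prop :=
  ∀ s₀ > 0, ∀ ε₂ ∈ Ioo (0 : ℝ) 1, ∀ τ ∈ Ioo (0 : ℝ) 1, ∃ eta : ℝ,
    0 < eta ∧ eta ≤ ε₂ ∧
    ∀ x s k, (x, 5 * s) ∈ S.U → x ∈ core S.Ω s₀ → 5 * s < s₀ → k < S.m →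
      S.d k x (4 * s) ≤ eta → ε₂ ≤ S.d (k + 1) x (4 * s) →
      ∃ V : Submodule ℝ (EuclideanSpace ℝ (Fin n)), Module.finrank ℝ V = k ∧
        ∀ y ∈ ball x s \ thickening (τ * s) ((x + ·) '' (V : Set (EuclideanSpace ℝ (Fin n)))),
          eta < S.d 0 y (4 * s)

/-- The singular stratum `S^k_{r, r₀, δ}`. -/
def strat (k : ℕ) (r r₀ δ : ℝ) : Set (EuclideanSpace ℝ (Fin n)) :=
  {x ∈ core S.Ω r₀ | 0 < S.Θ 0 x ∧ ∀ s, r ≤ s → s ≤ r₀ → δ ≤ S.d (k + 1) x s}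

/-- The singular stratum `S^k_{r₀, δ} := ⋂_{0 < r ≤ r₀} S^k_{r, r₀, δ}`. -/
def stratInt (k : ℕ) (r₀ δ : ℝ) : Set (EuclideanSpace ℝ (Fin n)) :=
  ⋂ r ∈ Ioc (0 : ℝ) r₀, S.strat k r r₀ δ

/-- The singular stratum `S^k_{r₀} := ⋃_{0 < δ < 1} S^k_{r₀, δ}`. -/
def stratFull (k : ℕ) (r₀ : ℝ) : Set (EuclideanSpace ℝ (Fin n)) :=
  ⋃ δ ∈ Ioo (0 : ℝ) 1, S.stratInt k r₀ δ

end StratSetting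

theorem aux_cover {n : ℕ} (hn : 0 < n) (V : Submodule ℝ (EuclideanSpace ℝ (Fin n))) (k : ℕ)
    (hV : Module.finrank ℝ V ≤ k) (q : ℕ) (hq : 0 < q) (s : ℝ) (hs : 0 < s)
    (x : EuclideanSpace ℝ (Fin n)) (E : Set (EuclideanSpace ℝ (Fin n)))
    (hE : ∀ y ∈ E, y ∈ ball x s ∧
      y ∈ thickening (1 / (4 * q) * s) ((x + ·) '' (V : Set (EuclideanSpace ℝ (Fin n))))) :
    ∃ f : EuclideanSpace ℝ (Fin n) → ℕ, (∀ y ∈ E, f y < (8 * n * q) ^ k) ∧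
      ∀ y ∈ E, ∀ y' ∈ E, f y = f y' → dist y y' < s / q := by
  classical
  have hn' : (1:ℝ) ≤ n := by exact_mod_cast hn
  have hq' : (1:ℝ) ≤ q := by exact_mod_cast hq
  have hp : ∀ y : EuclideanSpace ℝ (Fin n), ∃ p : V, y ∈ E → dist y (x + p) < 1 / (4 * q) * s := by
    intro y
    by_cases hy : y ∈ E
    · obtain ⟨z, ⟨p, hp, rfl⟩, hz⟩ := mem_thickening_iff.1 (hE y hy).2
      exact ⟨⟨p, hp⟩, fun _ => hz⟩
    · exact ⟨0, fun h => absurd h hy⟩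
  choose p hp using hp
  set e := stdOrthonormalBasis ℝ V with he
  set h : ℝ := s / (2 * n * q) with hh
  have hhpos : 0 < h := by positivity
  have hsig : 1 / (4 * (q:ℝ)) * s = s / q / 4 := by field_simp
  have hsq : s / q ≤ s := div_le_self hs.le hq'
  have hnorm : ∀ y ∈ E, ‖p y‖ < 2 * s := by
    intro y hy
    have h1 := hp y hy
    have h2 := (hE y hy).1
    rw [mem_ball] at h2
    have h3 : dist (x + (p y : EuclideanSpace ℝ (Fin n))) x = ‖p y‖ := by
      simp [dist_eq_norm]
    have h4 := dist_triangle_left (x + (p y : EuclideanSpace ℝ (Fin n))) x y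
    rw [h3] at h4
    rw [hsig] at h1
    linarith
  have hcoord : ∀ v : V, ∀ i, |e.repr v i| ≤ ‖v‖ := by
    intro v i
    rw [← e.repr.norm_map v, ← Real.norm_eq_abs]
    exact PiLp.norm_apply_le _ i
  set N : ℕ := 8 * n * q with hN
  have hNh : (N : ℝ) * h = 4 * s := by
    rw [hN, hh]; push_cast; field_simp; norm_num
  have hNpos : 0 < N := by positivity
  let g : EuclideanSpace ℝ (Fin n) → (Fin (Module.finrank ℝ V) → Fin N) := fun y i =>
    ⟨min (⌊(e.repr (p y) i + 2 * s) / h⌋₊) (N - 1), by omega⟩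
  have hcard : Fintype.card (Fin (Module.finrank ℝ V) → Fin N) ≤ N ^ k := by
    simp only [Fintype.card_fun, Fintype.card_fin]
    exact Nat.pow_le_pow_right hNpos hV
  refine ⟨fun y => (Fintype.equivFin _ (g y)).1, fun y _ => (Fin.is_lt _).trans_le hcard, ?_⟩
  intro y hy y' hy' hf
  have hg : g y = g y' := (Fintype.equivFin _).injective (Fin.ext hf)
  have hfl : ∀ z ∈ E, ∀ i, ((g z i : ℕ) : ℝ) ≤ (e.repr (p z) i + 2 * s) / h ∧
      (e.repr (p z) i + 2 * s) / h < (g z i : ℕ) + 1 := by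
    intro z hz i
    have h1 := abs_lt.1 ((hcoord (p z) i).trans_lt (hnorm z hz))
    have h0 : 0 ≤ (e.repr (p z) i + 2 * s) / h := div_nonneg (by linarith) hhpos.le
    have h2 : (e.repr (p z) i + 2 * s) / h < N := by
      rw [div_lt_iff₀ hhpos, hNh]; linarith
    have h3 : ⌊(e.repr (p z) i + 2 * s) / h⌋₊ < N := (Nat.floor_lt h0).2 h2
    have h4 : (g z i : ℕ) = ⌊(e.repr (p z) i + 2 * s) / h⌋₊ := by
      simp only [g]; omega
    rw [h4]
    exact ⟨Nat.floor_le h0, Nat.lt_floor_add_one _⟩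
  have hdiff : ∀ i, |e.repr (p y - p y') i| ≤ h := by
    intro i
    have h1 := hfl y hy i
    have h2 := hfl y' hy' i
    rw [hg] at h1
    have e1 : e.repr (p y - p y') i = e.repr (p y) i - e.repr (p y') i := by simp
    rw [e1]
    have a1 := h1.1; have a2 := h1.2; have a3 := h2.1; have a4 := h2.2
    rw [le_div_iff₀ hhpos] at a1 a3
    rw [div_lt_iff₀ hhpos] at a2 a4
    rw [abs_le]; constructor <;> linarith
  have hd : ‖p y - p y'‖ ≤ n * h := by
    have hj : Module.finrank ℝ V ≤ n := by
      have := Submodule.finrank_le V; simpa using this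
    rw [← e.repr.norm_map, EuclideanSpace.norm_eq]
    apply Real.sqrt_le_iff.2
    refine ⟨by positivity, ?_⟩
    calc ∑ i, ‖e.repr (p y - p y') i‖ ^ 2 ≤ ∑ i : Fin (Module.finrank ℝ V), h ^ 2 := by
          apply Finset.sum_le_sum; intro i _
          rw [Real.norm_eq_abs]
          exact pow_le_pow_left₀ (abs_nonneg _) (hdiff i) 2
      _ = (Module.finrank ℝ V : ℝ) * h ^ 2 := by simp
      _ ≤ (n : ℝ) * h ^ 2 := by gcongr
      _ ≤ (n * h) ^ 2 := by
          rw [mul_pow]; gcongr; nlinarith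
  have hnh : n * h = s / q / 2 := by rw [hh]; field_simp
  have t1 := hp y hy
  have t2 := hp y' hy'
  rw [hsig] at t1 t2
  have t3 : dist (x + (p y : EuclideanSpace ℝ (Fin n))) (x + (p y' : EuclideanSpace ℝ (Fin n)))
      = ‖p y - p y'‖ := by
    rw [dist_add_left, dist_eq_norm]; rfl
  have t4 := dist_triangle4 y (x + (p y : EuclideanSpace ℝ (Fin n)))
    (x + (p y' : EuclideanSpace ℝ (Fin n))) y'
  rw [dist_comm (x + (p y' : EuclideanSpace ℝ (Fin n))) y'] at t4
  linarith

theorem aux_cover_top {n : ℕ} (hn : 0 < n) (q : ℕ) (hq : 0 < q) (s : ℝ) (hs : 0 < s)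
    (x : EuclideanSpace ℝ (Fin n)) (E : Set (EuclideanSpace ℝ (Fin n)))
    (hE : ∀ y ∈ E, y ∈ ball x s) :
    ∃ f : EuclideanSpace ℝ (Fin n) → ℕ, (∀ y ∈ E, f y < (8 * n * q) ^ n) ∧
      ∀ y ∈ E, ∀ y' ∈ E, f y = f y' → dist y y' < s / q := by
  refine aux_cover hn ⊤ n (by simp) q hq s hs x E fun y hy => ⟨hE y hy, ?_⟩
  refine self_subset_thickening (by positivity) _ ⟨y - x, by simp, by simp⟩

theorem aux_union {X : Type*} [PseudoMetricSpace X] [MeasurableSpace X] (μ : Measure X)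
    (r : ℝ) (E : Set X) (f : X → ℕ) (a : ℕ) (hf : ∀ y ∈ E, f y < a) (c : ENNReal)
    (hc : ∀ i < a, μ (thickening r (E ∩ f ⁻¹' {i})) ≤ c) :
    μ (thickening r E) ≤ a * c := by
  have h1 : thickening r E ⊆ ⋃ i ∈ Finset.range a, thickening r (E ∩ f ⁻¹' {i}) := by
    intro z hz
    obtain ⟨y, hy, hzy⟩ := mem_thickening_iff.1 hz
    simp only [mem_iUnion]
    exact ⟨f y, by simpa using hf y hy, mem_thickening_iff.2 ⟨y, ⟨hy, rfl⟩, hzy⟩⟩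
  calc μ (thickening r E) ≤ μ (⋃ i ∈ Finset.range a, thickening r (E ∩ f ⁻¹' {i})) :=
        measure_mono h1
    _ ≤ ∑ i ∈ Finset.range a, μ (thickening r (E ∩ f ⁻¹' {i})) :=
        measure_biUnion_finset_le _ _
    _ ≤ ∑ i ∈ Finset.range a, c :=
        Finset.sum_le_sum fun i hi => hc i (by simpa using hi)
    _ = a * c := by simp

theorem aux_induct {X : Type*} [PseudoMetricSpace X] [MeasurableSpace X] (μ : Measure X)
    (r : ℝ) (S : Set X) (σ : ℕ → ℝ) (J a B : ℕ) (ha : 1 ≤ a) (hB : 1 ≤ B) (v : ENNReal)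
    (bad : X → ℕ → Prop)
    (hbase : ∀ E ⊆ S, (∀ y ∈ E, ∀ y' ∈ E, dist y y' < σ J) → μ (thickening r E) ≤ v)
    (hgood : ∀ j < J, ∀ E ⊆ S, (∀ y ∈ E, ∀ y' ∈ E, dist y y' < σ j) → (∀ y ∈ E, ¬ bad y j) →
      ∃ f : X → ℕ, (∀ y ∈ E, f y < a) ∧ ∀ y ∈ E, ∀ y' ∈ E, f y = f y' → dist y y' < σ (j + 1))
    (hbad : ∀ j < J, ∀ E ⊆ S, (∀ y ∈ E, ∀ y' ∈ E, dist y y' < σ j) →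
      ∃ f : X → ℕ, (∀ y ∈ E, f y < B) ∧ ∀ y ∈ E, ∀ y' ∈ E, f y = f y' → dist y y' < σ (j + 1)) :
    open Classical in
    ∀ t j, j + t = J → ∀ b, ∀ E ⊆ S, (∀ y ∈ E, ∀ y' ∈ E, dist y y' < σ j) →
      (∀ y ∈ E, ((Finset.Ico j J).filter (bad y)).card ≤ b) →
      μ (thickening r E) ≤ ((B ^ b * (2 * a) ^ t : ℕ) : ENNReal) * v := by
  classical
  intro t
  induction t with
  | zero =>
    intro j hj b E hE hd hb
    have hj' : j = J := by omega
    subst hj'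
    have h1 := hbase E hE hd
    have h2 : (1 : ENNReal) ≤ ((B ^ b * (2 * a) ^ 0 : ℕ) : ENNReal) := by
      have : 1 ≤ B ^ b * (2 * a) ^ 0 := by simpa using Nat.one_le_pow _ _ hB
      exact_mod_cast this
    calc μ (thickening r E) ≤ 1 * v := by simpa using h1
      _ ≤ _ := by gcongr
  | succ t ih =>
    intro j hj b E hE hd hb
    have hjJ : j < J := by omega
    have hsplit : ∀ y, ((Finset.Ico j J).filter (bad y)).card
        = (if bad y j then 1 else 0) + ((Finset.Ico (j + 1) J).filter (bad y)).card := by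
      intro y
      rw [← Finset.insert_Ico_add_one_left_eq_Ico hjJ, Finset.filter_insert]
      split_ifs with h
      · rw [Finset.card_insert_of_notMem (by simp)]; omega
      · simp
    set G : Set X := {y ∈ E | ¬ bad y j} with hG
    set D : Set X := {y ∈ E | bad y j} with hD
    have hGE : G ⊆ E := fun y hy => hy.1
    have hDE : D ⊆ E := fun y hy => hy.1
    have hED : E = G ∪ D := by
      ext y; simp only [hG, hD, mem_union, mem_ofPred_eq]; tauto
    have hGb : μ (thickening r G) ≤ a * (((B ^ b * (2 * a) ^ t : ℕ) : ENNReal) * v) := by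
      obtain ⟨f, hf1, hf2⟩ := hgood j hjJ G (hGE.trans hE)
        (fun y hy y' hy' => hd y (hGE hy) y' (hGE hy')) (fun y hy => hy.2)
      refine aux_union μ r G f a hf1 _ fun i _ => ?_
      refine ih (j + 1) (by omega) b _ (fun y hy => hE (hGE hy.1)) ?_ ?_
      · intro y hy y' hy'
        exact hf2 y hy.1 y' hy'.1 (by rw [hy.2, hy'.2])
      · intro y hy
        have := hb y (hGE hy.1)
        rw [hsplit y] at this
        omega
    have hDb : μ (thickening r D) ≤ ((B ^ b * (2 * a) ^ t : ℕ) : ENNReal) * v := by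
      rcases D.eq_empty_or_nonempty with h0 | ⟨y₀, hy₀⟩
      · rw [h0]; simp
      have hb0 : 1 ≤ b := by
        have := hb y₀ (hDE hy₀)
        rw [hsplit y₀, if_pos hy₀.2] at this
        omega
      obtain ⟨c, rfl⟩ : ∃ c, b = c + 1 := ⟨b - 1, by omega⟩
      obtain ⟨f, hf1, hf2⟩ := hbad j hjJ D (hDE.trans hE)
        (fun y hy y' hy' => hd y (hDE hy) y' (hDE hy'))
      have := aux_union μ r D f B hf1 (((B ^ c * (2 * a) ^ t : ℕ) : ENNReal) * v) fun i _ => by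
        refine ih (j + 1) (by omega) c _ (fun y hy => hE (hDE hy.1)) ?_ ?_
        · intro y hy y' hy'
          exact hf2 y hy.1 y' hy'.1 (by rw [hy.2, hy'.2])
        · intro y hy
          have h1 := hb y (hDE hy.1)
          rw [hsplit y, if_pos hy.1.2] at h1
          omega
      refine this.trans (le_of_eq ?_)
      push_cast
      ring
    have hun : thickening r E ⊆ thickening r G ∪ thickening r D := by
      rw [hED, thickening_union]
    calc μ (thickening r E) ≤ μ (thickening r G) + μ (thickening r D) :=
          (measure_mono hun).trans (measure_union_le _ _)
      _ ≤ a * (((B ^ b * (2 * a) ^ t : ℕ) : ENNReal) * v)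
          + 1 * (((B ^ b * (2 * a) ^ t : ℕ) : ENNReal) * v) := by
          rw [one_mul]; exact add_le_add hGb hDb
      _ ≤ a * (((B ^ b * (2 * a) ^ t : ℕ) : ENNReal) * v)
          + a * (((B ^ b * (2 * a) ^ t : ℕ) : ENNReal) * v) := by
          gcongr; exact_mod_cast ha
      _ = ((B ^ b * (2 * a) ^ (t + 1) : ℕ) : ENNReal) * v := by
          push_cast; ring

theorem aux_chain {n : ℕ} (S : StratSetting n) (hII : S.HypII) (r₀ : ℝ) (hr₀ : 0 < r₀)
    (τ : ℝ) (hτ : τ ∈ Ioo (0 : ℝ) 1) :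
    ∀ l, l ≤ S.m → ∀ ε ∈ Ioo (0 : ℝ) 1, ∃ ε₀ > 0, ε₀ ≤ ε ∧
      ∀ x s, (x, 5 * s) ∈ S.U → x ∈ core S.Ω r₀ → 5 * s < r₀ →
        S.d 0 x (4 * s) ≤ ε₀ → ε ≤ S.d l x (4 * s) →
        ∃ V : Submodule ℝ (EuclideanSpace ℝ (Fin n)), Module.finrank ℝ V < l ∧
          ∀ y ∈ ball x s \ thickening (τ * s) ((x + ·) '' (V : Set (EuclideanSpace ℝ (Fin n)))),
            ε₀ < S.d 0 y (4 * s) := by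
  intro l
  induction l with
  | zero =>
    intro _ ε hε
    refine ⟨ε / 2, half_pos hε.1, by linarith [hε.1], ?_⟩
    intro x s _ _ _ h1 h2
    linarith [hε.1]
  | succ l ih =>
    intro hl ε hε
    obtain ⟨eta, he0, heε, H⟩ := hII r₀ hr₀ ε hε τ hτ
    obtain ⟨ε₀, h0, hle, H'⟩ := ih (by omega) eta ⟨he0, heε.trans_lt hε.2⟩
    refine ⟨ε₀, h0, hle.trans heε, ?_⟩
    intro x s hU hx hs h1 h2
    by_cases hd : S.d l x (4 * s) ≤ eta
    · obtain ⟨V, hV, HV⟩ := H x s l hU hx hs (by omega) hd h2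
      exact ⟨V, by omega, fun y hy => hle.trans_lt (HV y hy)⟩
    · obtain ⟨V, hV, HV⟩ := H' x s hU hx hs h1 (not_le.1 hd).le
      exact ⟨V, by omega, HV⟩

theorem aux_telescope (g : ℕ → ℝ) (p J : ℕ) :
    ∑ i ∈ Finset.range J, (g i - g (i + p))
      = ∑ i ∈ Finset.range p, g i - ∑ i ∈ Finset.range p, g (J + i) := by
  induction J with
  | zero => simp
  | succ J ih =>
    rw [Finset.sum_range_succ, ih]
    have h1 := Finset.sum_range_succ (fun i => g (J + i)) p
    have h2 := Finset.sum_range_succ' (fun i => g (J + i)) p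
    have h3 : ∑ i ∈ Finset.range p, g (J + (i + 1)) = ∑ i ∈ Finset.range p, g (J + 1 + i) :=
      Finset.sum_congr rfl fun i _ => by congr 1; ring
    simp only [add_zero] at h1 h2
    rw [h3] at h2
    linarith

theorem aux_count (g : ℕ → ℝ) (p J : ℕ) (Λ eta : ℝ) (heta : 0 < eta)
    (hg0 : ∀ i, 0 ≤ g i) (hg1 : ∀ i, g i ≤ Λ) (hanti : Antitone g)
    (P : ℕ → Prop) [DecidablePred P] (hP : ∀ i, P i → eta ≤ g i - g (i + p)) :
    ((Finset.Ico 0 J).filter P).card ≤ ⌈p * Λ / eta⌉₊ := by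
  have h1 : (((Finset.Ico 0 J).filter P).card : ℝ) * eta ≤ p * Λ := by
    calc (((Finset.Ico 0 J).filter P).card : ℝ) * eta
        = ∑ i ∈ (Finset.Ico 0 J).filter P, eta := by simp
      _ ≤ ∑ i ∈ (Finset.Ico 0 J).filter P, (g i - g (i + p)) :=
          Finset.sum_le_sum fun i hi => hP i (Finset.mem_filter.1 hi).2
      _ ≤ ∑ i ∈ Finset.Ico 0 J, (g i - g (i + p)) :=
          Finset.sum_le_sum_of_subset_of_nonneg (Finset.filter_subset _ _)
            fun i _ _ => sub_nonneg.2 (hanti (by omega))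
      _ = ∑ i ∈ Finset.range p, g i - ∑ i ∈ Finset.range p, g (J + i) := by
          rw [← Finset.range_eq_Ico, aux_telescope]
      _ ≤ ∑ i ∈ Finset.range p, g i := by
          have : 0 ≤ ∑ i ∈ Finset.range p, g (J + i) := Finset.sum_nonneg fun i _ => hg0 _
          linarith
      _ ≤ ∑ i ∈ Finset.range p, Λ := Finset.sum_le_sum fun i _ => hg1 i
      _ = p * Λ := by simp
  have h2 : (((Finset.Ico 0 J).filter P).card : ℝ) ≤ p * Λ / eta := by
    rwa [le_div_iff₀ heta]
  exact_mod_cast h2.trans (Nat.le_ceil _)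

theorem aux_core_anti {n : ℕ} (Ω : Set (EuclideanSpace ℝ (Fin n))) {s s' : ℝ} (h : s ≤ s')
    {x : EuclideanSpace ℝ (Fin n)} (hx : x ∈ core Ω s') : x ∈ core Ω s :=
  ⟨hx.1, by linarith [hx.2]⟩

theorem aux_Theta_mono {n : ℕ} (S : StratSetting n) {r₀ s s' : ℝ} (h0 : 0 ≤ s) (h : s ≤ s')
    (hs' : s' ≤ r₀) {x : EuclideanSpace ℝ (Fin n)} (hx : x ∈ core S.Ω r₀) :
    S.Θ s x ≤ S.Θ s' x := by
  rcases h.eq_or_lt with rfl | h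
  · exact le_rfl
  · exact S.Θ_mono s s' x h0 h (aux_core_anti _ hs' hx)

theorem aux_fixed_k {n : ℕ} (S : StratSetting n)
    (hI : S.HypI) (hII : S.HypII)
    (κ₀ δ : ℝ) (hκ₀ : κ₀ ∈ Ioo (0 : ℝ) 1) (hδ : δ ∈ Ioo (0 : ℝ) 1)
    (r₀ : ℝ) (hr₀ : 0 < r₀) (k : ℕ) (hk : k + 1 ≤ S.m) :
    ∃ C > 0, ∀ r, 0 < r → r < r₀ →
      volume (thickening r (S.strat k r r₀ δ)) ≤
        ENNReal.ofReal (C * r ^ ((n : ℝ) - (k : ℝ) - κ₀)) := by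
  classical
  have hn := S.npos
  -- choice of `q`
  obtain ⟨q, hq2, hqκ⟩ : ∃ q : ℕ, 2 ≤ q ∧ 2 * (8 * (n : ℝ)) ^ k ≤ (q : ℝ) ^ κ₀ := by
    have h1 : Tendsto (fun q : ℕ => (q : ℝ) ^ κ₀) atTop atTop :=
      (tendsto_rpow_atTop hκ₀.1).comp tendsto_natCast_atTop_atTop
    obtain ⟨q, h2, h3⟩ := ((eventually_ge_atTop 2).and
      (h1.eventually_ge_atTop (2 * (8 * (n : ℝ)) ^ k))).exists
    exact ⟨q, h2, h3⟩
  have hq0 : 0 < q := by omega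
  have hqR : (2 : ℝ) ≤ q := by exact_mod_cast hq2
  have hqpos : (0 : ℝ) < q := by linarith
  have hτ : (1 / (4 * (q : ℝ))) ∈ Ioo (0 : ℝ) 1 := by
    refine ⟨by positivity, ?_⟩
    rw [div_lt_one (by positivity)]; linarith
  obtain ⟨ε₀, hε₀, -, Hch⟩ := aux_chain S hII r₀ hr₀ _ hτ (k + 1) hk δ hδ
  obtain ⟨lam, eta, hlam0, hlam1, heta0, heta1, HI⟩ := hI r₀ hr₀ ε₀ hε₀
  obtain ⟨Λ, hΛ, HΛ⟩ := S.Θ_bdd r₀ hr₀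
  obtain ⟨p, hp⟩ : ∃ p : ℕ, (1 / (q : ℝ)) ^ p < lam :=
    exists_pow_lt_of_lt_one hlam0 (by rw [div_lt_one hqpos]; linarith)
  set σ : ℕ → ℝ := fun j => r₀ / 10 / (q : ℝ) ^ j with hσ
  have hσpos : ∀ j, 0 < σ j := fun j => by simp only [hσ]; positivity
  have hσsucc : ∀ j, σ (j + 1) = σ j / q := fun j => by
    simp only [hσ, pow_succ]; field_simp
  have hσle : ∀ j, σ j ≤ r₀ / 10 := fun j => by
    simp only [hσ]
    exact div_le_self (by positivity) (one_le_pow₀ (by linarith))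
  have hσanti : Antitone σ := antitone_nat_of_succ_le fun j => by
    rw [hσsucc]; exact div_le_self (hσpos j).le (by linarith)
  have hσp : ∀ j, σ (j + p) ≤ lam * σ j := fun j => by
    have : σ (j + p) = (1 / (q : ℝ)) ^ p * σ j := by
      simp only [hσ, pow_add, div_pow, one_pow]; field_simp
    rw [this]
    exact mul_le_mul_of_nonneg_right hp.le (hσpos j).le
  set a : ℕ := (8 * n * q) ^ k with ha
  set B : ℕ := (8 * n * q) ^ n with hB
  have ha1 : 1 ≤ a := Nat.one_le_pow _ _ (by positivity)
  have hB1 : 1 ≤ B := Nat.one_le_pow _ _ (by positivity)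
  set M : ℕ := ⌈p * Λ / eta⌉₊ with hM
  -- initial covering
  obtain ⟨R, hR0, hR⟩ := S.isBounded.subset_ball_lt 0 (0 : EuclideanSpace ℝ (Fin n))
  obtain ⟨Q, hQ⟩ : ∃ Q : ℕ, R / σ 0 < Q := exists_nat_gt _
  have hQpos : (0 : ℝ) < Q := (div_pos hR0 (hσpos 0)).trans hQ
  have hQ0 : 0 < Q := by exact_mod_cast hQpos
  have hRQ : R / Q ≤ σ 0 := by
    rw [div_lt_iff₀ (hσpos 0)] at hQ
    rw [div_le_iff₀ hQpos]; linarith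
  set N₀ : ℕ := (8 * n * Q) ^ n with hN₀
  have hN₀1 : 1 ≤ N₀ := Nat.one_le_pow _ _ (by positivity)
  set ω : ℝ := (volume (ball (0 : EuclideanSpace ℝ (Fin n)) 1)).toReal with hω
  have hωpos : 0 < ω := ENNReal.toReal_pos (measure_ball_pos _ _ one_pos).ne'
    measure_ball_lt_top.ne
  refine ⟨N₀ * B ^ M * (2 ^ n * ω) * (q * r₀) ^ ((k : ℝ) + κ₀), by positivity, ?_⟩
  intro r hr hrr
  -- the last scale
  have hex : ∃ j, 4 * σ j < r := by
    obtain ⟨j, hj⟩ := exists_pow_lt_of_lt_one (div_pos hr hr₀)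
      (show 1 / (q : ℝ) < 1 by rw [div_lt_one hqpos]; linarith)
    refine ⟨j, ?_⟩
    have : σ j = r₀ / 10 * (1 / (q : ℝ)) ^ j := by
      simp only [hσ, div_pow, one_pow]; field_simp
    rw [lt_div_iff₀ hr₀] at hj
    rw [this]
    nlinarith [pow_pos (show (0 : ℝ) < 1 / q by positivity) j]
  obtain ⟨J, hJ1, hJ2⟩ : ∃ J, 4 * σ J < r ∧ ∀ j < J, r ≤ 4 * σ j :=
    ⟨Nat.find hex, Nat.find_spec hex, fun j hj => not_lt.1 (Nat.find_min hex hj)⟩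
  have hqJ : (q : ℝ) ^ J ≤ q * r₀ / r := by
    rw [le_div_iff₀ hr]
    rcases J with _ | J
    · simp only [pow_zero, one_mul]; nlinarith
    · have := hJ2 J (by omega)
      simp only [hσ] at this
      rw [← mul_div_assoc, le_div_iff₀ (by positivity)] at this
      rw [pow_succ]
      nlinarith
  set T := S.strat k r r₀ δ with hT
  set bad : EuclideanSpace ℝ (Fin n) → ℕ → Prop := fun x i =>
    eta < S.Θ (4 * σ i) x - S.Θ (lam * (4 * σ i)) x with hbad
  have hd0 : ∀ j < J, ∀ y ∈ T, ¬ bad y j → S.d 0 y (4 * σ j) ≤ ε₀ := by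
    intro j hj y hy hb
    have h1 := hσle j
    exact HI y (4 * σ j) ⟨aux_core_anti _ (by linarith) hy.1, hy.2.1⟩ hy.1 (by linarith)
      (not_lt.1 hb)
  have hind := aux_induct (volume : Measure (EuclideanSpace ℝ (Fin n))) r T σ J a B ha1 hB1
    (volume (ball (0 : EuclideanSpace ℝ (Fin n)) (2 * r))) bad ?_ ?_ ?_ J 0 (by omega) M
  · have hfin : volume (thickening r T) ≤
        N₀ * (((B ^ M * (2 * a) ^ J : ℕ) : ENNReal) *
          volume (ball (0 : EuclideanSpace ℝ (Fin n)) (2 * r))) := by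
      obtain ⟨f, hf1, hf2⟩ := aux_cover_top hn Q hQ0 R hR0 0 T (fun y hy => hR hy.1.1)
      refine aux_union volume r T f N₀ hf1 _ fun i _ => ?_
      refine hind _ inter_subset_left ?_ ?_
      · intro y hy y' hy'
        exact (hf2 y hy.1 y' hy'.1 (by rw [hy.2, hy'.2])).trans_le hRQ
      · intro y hy
        have hyc : y ∈ core S.Ω r₀ := hy.1.1
        refine aux_count (fun i => S.Θ (4 * σ i) y) p J Λ eta heta0 ?_ ?_ ?_ (bad y) ?_
        · intro i
          have h1 := hσle i
          have h2 := hσpos i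
          exact S.Θ_nonneg _ _ (by linarith) (aux_core_anti _ (by linarith) hyc)
        · intro i
          have h1 := hσle i
          have h2 := hσpos i
          exact HΛ _ _ (by linarith) (by linarith) hyc
        · intro i j hij
          have h1 := hσle i
          have h2 := hσpos j
          have h3 := hσanti hij
          exact aux_Theta_mono S (by linarith) (by linarith) (by linarith) hyc
        · intro i hi
          have h1 := hσle i
          have h2 := hσpos (i + p)
          have h3 := hσp i
          have h4 := hσpos i
          have h5 : S.Θ (4 * σ (i + p)) y ≤ S.Θ (lam * (4 * σ i)) y :=
            aux_Theta_mono S (r₀ := r₀) (by linarith) (by linarith) (by nlinarith) hyc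
          have h6 : eta < S.Θ (4 * σ i) y - S.Θ (lam * (4 * σ i)) y := hi
          linarith
    refine hfin.trans ?_
    have hvol : volume (ball (0 : EuclideanSpace ℝ (Fin n)) (2 * r))
        = ENNReal.ofReal ((2 * r) ^ n * ω) := by
      rw [Measure.addHaar_ball_of_pos _ _ (by positivity), hω,
        ENNReal.ofReal_mul (by positivity), ENNReal.ofReal_toReal measure_ball_lt_top.ne]
      simp
    rw [hvol, ← ENNReal.ofReal_natCast, ← ENNReal.ofReal_natCast,
      ← ENNReal.ofReal_mul (by positivity), ← ENNReal.ofReal_mul (by positivity)]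
    apply ENNReal.ofReal_le_ofReal
    have h2a : (((2 * a) ^ J : ℕ) : ℝ) ≤ (q * r₀) ^ ((k : ℝ) + κ₀) * r ^ (-((k : ℝ) + κ₀)) := by
      have e1 : (((2 * a : ℕ)) : ℝ) ≤ (q : ℝ) ^ ((k : ℝ) + κ₀) := by
        rw [ha, Real.rpow_add hqpos, Real.rpow_natCast]
        push_cast
        rw [mul_pow]
        have : (0 : ℝ) < (q : ℝ) ^ k := by positivity
        nlinarith
      have e2 : 0 ≤ (k : ℝ) + κ₀ := by have := hκ₀.1; positivity
      calc (((2 * a) ^ J : ℕ) : ℝ) = ((2 * a : ℕ) : ℝ) ^ J := by push_cast; ring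
        _ ≤ ((q : ℝ) ^ ((k : ℝ) + κ₀)) ^ J := by gcongr
        _ = ((q : ℝ) ^ J) ^ ((k : ℝ) + κ₀) := by
            rw [← Real.rpow_natCast, ← Real.rpow_natCast, ← Real.rpow_mul hqpos.le,
              ← Real.rpow_mul hqpos.le, mul_comm]
        _ ≤ (q * r₀ / r) ^ ((k : ℝ) + κ₀) := Real.rpow_le_rpow (by positivity) hqJ e2
        _ = _ := by
            rw [Real.div_rpow (by positivity) hr.le, Real.rpow_neg hr.le, div_eq_mul_inv]
    have hrn : r ^ ((n : ℝ) - k - κ₀) = r ^ n * r ^ (-((k : ℝ) + κ₀)) := by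
      rw [← Real.rpow_natCast r n, ← Real.rpow_add hr]; congr 1; ring
    rw [hrn, Nat.cast_mul (B ^ M)]
    calc (N₀ : ℝ) * (((B ^ M : ℕ) : ℝ) * (((2 * a) ^ J : ℕ) : ℝ) * ((2 * r) ^ n * ω))
        ≤ (N₀ : ℝ) * (((B ^ M : ℕ) : ℝ) *
            ((q * r₀) ^ ((k : ℝ) + κ₀) * r ^ (-((k : ℝ) + κ₀))) * ((2 * r) ^ n * ω)) := by
          gcongr
      _ = _ := by push_cast; rw [mul_pow]; ring
  · intro E hE hd
    rcases E.eq_empty_or_nonempty with rfl | ⟨y, hy⟩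
    · simp
    have : thickening r E ⊆ ball y (2 * r) := by
      intro z hz
      obtain ⟨w, hw, hzw⟩ := mem_thickening_iff.1 hz
      have h1 := hd w hw y hy
      have h2 := dist_triangle z w y
      have h3 := hσpos J
      rw [mem_ball]; linarith
    refine (measure_mono this).trans (le_of_eq ?_)
    rw [Measure.addHaar_ball_center]
  · intro j hj E hE hd hg
    rcases E.eq_empty_or_nonempty with rfl | ⟨x, hx⟩
    · exact ⟨fun _ => 0, by simp, by simp⟩
    have h1 := hσle j
    have h2 := hσpos j
    have hxT := hE hx
    obtain ⟨V, hV, HV⟩ := Hch x (σ j) ⟨aux_core_anti _ (by linarith) hxT.1, hxT.2.1⟩ hxT.1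
      (by linarith) (hd0 j hj x hxT (hg x hx)) (hxT.2.2 _ (hJ2 j hj) (by linarith))
    rw [hσsucc]
    refine aux_cover hn V k (by omega) q hq0 (σ j) h2 x E fun y hy => ?_
    refine ⟨hd y hy x hx, ?_⟩
    by_contra hc
    exact absurd (HV y ⟨hd y hy x hx, hc⟩) (not_lt.2 (hd0 j hj y (hE hy) (hg y hy)))
  · intro j hj E hE hd
    rcases E.eq_empty_or_nonempty with rfl | ⟨x, hx⟩
    · exact ⟨fun _ => 0, by simp, by simp⟩
    rw [hσsucc]
    exact aux_cover_top hn q hq0 (σ j) (hσpos j) x E fun y hy => hd y hy x hx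

/-- Theorem (Volume of the neighborhoods of singular strata, estimate (2.4)):
under the Structural Hypotheses, for every `κ₀, δ ∈ (0,1)` and `r₀ > 0` there is a constant
`C > 0` such that `|𝒯_r(S^k_{r,r₀,δ})| ≤ C r^{n-k-κ₀}` for all `k ∈ {1,…,m-1}` and
`0 < r < r₀`. -/
theorem abstract_tubular_neighborhood_estimate {n : ℕ} (S : StratSetting n)
    (hI : S.HypI) (hII : S.HypII)
    (κ₀ δ : ℝ) (hκ₀ : κ₀ ∈ Ioo (0 : ℝ) 1) (hδ : δ ∈ Ioo (0 : ℝ) 1)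
    (r₀ : ℝ) (hr₀ : 0 < r₀) :
    ∃ C > 0, ∀ k, 1 ≤ k → k ≤ S.m - 1 → ∀ r, 0 < r → r < r₀ →
      volume (thickening r (S.strat k r r₀ δ)) ≤
        ENNReal.ofReal (C * r ^ ((n : ℝ) - (k : ℝ) - κ₀)) := by
  have hm := S.mpos
  have H : ∀ k : ℕ, ∃ C > 0, k + 1 ≤ S.m → ∀ r, 0 < r → r < r₀ →
      volume (thickening r (S.strat k r r₀ δ)) ≤
        ENNReal.ofReal (C * r ^ ((n : ℝ) - (k : ℝ) - κ₀)) := by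
    intro k
    by_cases hk : k + 1 ≤ S.m
    · obtain ⟨C, hC, h⟩ := aux_fixed_k S hI hII κ₀ δ hκ₀ hδ r₀ hr₀ k hk
      exact ⟨C, hC, fun _ => h⟩
    · exact ⟨1, one_pos, fun h => absurd h hk⟩
  choose C hC H using H
  refine ⟨∑ k ∈ Finset.range S.m, C k, Finset.sum_pos (fun k _ => hC k) ⟨0, by simpa using hm⟩, ?_⟩
  intro k _ hk r hr hrr
  refine (H k (by omega) r hr hrr).trans (ENNReal.ofReal_le_ofReal ?_)
  refine mul_le_mul_of_nonneg_right ?_ (by positivity)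
  exact Finset.single_le_sum (f := C) (fun i _ => (hC i).le) (Finset.mem_range.2 (by omega))
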